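/- For t > 0 define g₁(t) = (1-i)/√(2πt) - (1/π) ∫_{-∞}^∞ e^{-is²t}/(1+s²) ds. Then for every k ∈ ℂ with Re k ≤ 0 and Im k ≤ 0, the integral ∫₀^∞ e^{ik²t} g₁(t) dt converges absolutely (note |e^{ik²t}| = e^{-2 Re(k) Im(k) t} ≤ 1 for such k, and g₁ is integrable on (0,∞)), and i ∫₀^∞ e^{ik²t} g₁(t) dt = 1/(1 + ik). Equivalently, since ∫₀^∞ e^{-ikx} e^{-x} dx = 1/(1+ik) for Im k ≤ 0, the global relation q̂₀(k) = i·g̃₁(k) holds for all k in the closed third quadrant. -/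

import Mathlib

open Complex MeasureTheory Set

/-- The Neumann boundary value `g₁(t) = qₓ(0,t)` of the linear Schrödinger solution on the
half-line with initial datum `e^{-x}` and homogeneous Dirichlet boundary condition:
`g₁(t) = (1-i)/√(2πt) - (1/π) ∫_{-∞}^∞ e^{-is²t}/(1+s²) ds`. -/
noncomputable def neumannLS (t : ℝ) : ℂ :=
  (1 - Complex.I) / (Real.sqrt (2 * Real.pi * t) : ℂ)
    - (1 / (Real.pi : ℂ))
      * ∫ s : ℝ, Complex.exp (-Complex.I * (s : ℂ) ^ 2 * (t : ℂ)) / (1 + (s : ℂ) ^ 2)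

section

open Filter Topology

lemma ae_ne_zero : ∀ᵐ r : ℝ, r ≠ 0 := by
  simp [ae_iff]

lemma integrable_inv_one_add_mul_sq {m : ℝ} (hm : 0 < m) :
    Integrable fun s : ℝ => (1 + m * s ^ 2)⁻¹ := by
  have h := integrable_inv_one_add_sq.comp_mul_left' (R := √m) (Real.sqrt_pos.2 hm).ne'
  simpa only [mul_pow, Real.sq_sqrt hm.le] using h

lemma sq_add_norm_le_two_mul_norm_sq_add {c : ℂ} (hc : 0 ≤ c.re) (s : ℝ) :
    s ^ 2 + ‖c‖ ≤ 2 * ‖(s : ℂ) ^ 2 + c‖ := by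
  have h1 : ‖(s : ℂ) ^ 2 + c‖ ^ 2 = (s ^ 2 + c.re) ^ 2 + c.im ^ 2 := by
    rw [← Complex.normSq_eq_norm_sq, Complex.normSq_apply]
    simp [← Complex.ofReal_pow]
    ring
  have h2 : ‖c‖ ^ 2 = c.re ^ 2 + c.im ^ 2 := by
    rw [← Complex.normSq_eq_norm_sq, Complex.normSq_apply]
    ring
  refine le_of_sq_le_sq ?_ (by positivity)
  nlinarith [mul_nonneg (sq_nonneg s) hc, sq_nonneg (s ^ 2 - ‖c‖), sq_nonneg (s ^ 2 + c.re),
    sq_nonneg c.im]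

lemma sq_add_ne_zero {c : ℂ} (hc : 0 ≤ c.re) (hc0 : c ≠ 0) (s : ℝ) : (s : ℂ) ^ 2 + c ≠ 0 := by
  have h := sq_add_norm_le_two_mul_norm_sq_add hc s
  have : 0 < ‖c‖ := norm_pos_iff.2 hc0
  exact norm_pos_iff.1 (by nlinarith [sq_nonneg s])

lemma integrable_inv_sq_add {c : ℂ} (hc : 0 ≤ c.re) (hc0 : c ≠ 0) :
    Integrable fun s : ℝ => ((s : ℂ) ^ 2 + c)⁻¹ := by
  have hn : 0 < ‖c‖ := norm_pos_iff.2 hc0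
  refine ((integrable_inv_one_add_mul_sq (inv_pos.2 hn)).const_mul (2 / ‖c‖)).mono'
    (by fun_prop) (ae_of_all _ fun s => ?_)
  have h0 : 0 < ‖(s : ℂ) ^ 2 + c‖ := norm_pos_iff.2 (sq_add_ne_zero hc hc0 s)
  have h := sq_add_norm_le_two_mul_norm_sq_add hc s
  have h3 : 2 / ‖c‖ * (1 + ‖c‖⁻¹ * s ^ 2)⁻¹ = 2 / (s ^ 2 + ‖c‖) := by
    field_simp
    ring
  rw [h3, norm_inv, inv_eq_one_div, div_le_div_iff₀ h0 (by positivity)]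
  linarith

lemma tendsto_ofReal_inv_atTop : Tendsto (fun r : ℝ => (r : ℂ)⁻¹) atTop (𝓝 0) := by
  simpa [Function.comp_def] using
    (Complex.continuous_ofReal.tendsto 0).comp tendsto_inv_atTop_zero

lemma tendsto_log_add_mul_I_sub_log_sub_mul_I {a : ℂ} (ha : 0 < a.re) :
    Tendsto (fun r : ℝ => Complex.log (a + r * I) - Complex.log (a - r * I)) atTop
      (𝓝 (Real.pi * I)) := by
  have h0 : Tendsto (fun r : ℝ => a / (r : ℂ)) atTop (𝓝 0) := by
    simpa [div_eq_mul_inv] using tendsto_ofReal_inv_atTop.const_mul a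
  have h1 : Tendsto (fun r : ℝ => Complex.log (a / r + I) - Complex.log (a / r - I)) atTop
      (𝓝 (Complex.log I - Complex.log (-I))) := by
    refine Tendsto.sub ?_ ?_
    · refine Tendsto.clog ?_ (by simp [Complex.mem_slitPlane_iff])
      simpa using h0.add_const I
    · refine Tendsto.clog ?_ (by simp [Complex.mem_slitPlane_iff])
      simpa using h0.sub_const I
  have h2 : Complex.log I - Complex.log (-I) = Real.pi * I := by
    rw [Complex.log_I, Complex.log_neg_I]
    ring
  rw [← h2]
  refine h1.congr' ?_
  filter_upwards [eventually_gt_atTop 0] with r hr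
  have hr' : (r : ℂ) ≠ 0 := by exact_mod_cast hr.ne'
  have e1 : a + r * I = r * (a / r + I) := by field_simp
  have e2 : a - r * I = r * (a / r - I) := by field_simp
  have p : (a / r).re ≠ 0 := by
    rw [Complex.div_ofReal_re]
    exact (div_pos ha hr).ne'
  rw [e1, e2, Complex.log_ofReal_mul hr, Complex.log_ofReal_mul hr]
  · ring
  · exact fun h => p (by simpa using congrArg Complex.re h)
  · exact fun h => p (by simpa using congrArg Complex.re h)

lemma integral_inv_complex_sq_add_sq {a : ℂ} (ha : 0 < a.re) (ha2 : 0 ≤ (a ^ 2).re) :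
    ∫ r : ℝ, ((r : ℂ) ^ 2 + a ^ 2)⁻¹ = Real.pi / a := by
  have ha0 : a ≠ 0 := fun h => by simp [h] at ha
  have hlim := tendsto_log_add_mul_I_sub_log_sub_mul_I ha
  have key := integral_of_hasDerivAt_of_tendsto
    (f := fun r : ℝ => (2 * a * I)⁻¹ * (Complex.log (a + r * I) - Complex.log (a - r * I)))
    (f' := fun r : ℝ => ((r : ℂ) ^ 2 + a ^ 2)⁻¹)
    (m := (2 * a * I)⁻¹ * (-(Real.pi * I))) (n := (2 * a * I)⁻¹ * (Real.pi * I))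
    (fun r => ?_) (integrable_inv_sq_add ha2 (pow_ne_zero 2 ha0)) ?_ (hlim.const_mul _)
  · rw [key]
    field_simp
    ring
  · have q1 : 0 < (a + r * I).re := by simpa using ha
    have q2 : 0 < (a - r * I).re := by simpa using ha
    have n1 : a + r * I ≠ 0 := fun h => by simp [h] at q1
    have n2 : a - r * I ≠ 0 := fun h => by simp [h] at q2
    have n3 := sq_add_ne_zero ha2 (pow_ne_zero 2 ha0) r
    have d0 : HasDerivAt (fun r : ℝ => (r : ℂ) * I) I r := by
      simpa using (Complex.ofRealCLM.hasDerivAt (x := r)).mul_const I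
    have d1 := (d0.const_add a).clog_real (Or.inl q1)
    have d2 := (d0.const_sub a).clog_real (Or.inl q2)
    refine ((d1.sub d2).const_mul (2 * a * I)⁻¹).congr_deriv ?_
    have e : (r : ℂ) ^ 2 + a ^ 2 = (a + r * I) * (a - r * I) := by
      linear_combination (r : ℂ) ^ 2 * I_sq
    have e2 : I / (a + r * I) - -I / (a - r * I) =
        2 * a * I * ((a + r * I) * (a - r * I))⁻¹ := by
      rw [div_sub_div _ _ n1 n2, div_eq_mul_inv]
      ring
    rw [e, e2, inv_mul_cancel_left₀ (by simp [ha0])]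
  · refine Tendsto.const_mul _ ?_
    have := (hlim.comp tendsto_neg_atBot_atTop).neg
    refine this.congr fun r => ?_
    simp [sub_eq_add_neg]

lemma hasDerivAt_neg_div_sq_add {c : ℂ} {r : ℝ} (h : (r : ℂ) ^ 2 + c ≠ 0) :
    HasDerivAt (fun r : ℝ => -(r : ℂ) / ((r : ℂ) ^ 2 + c))
      (-((r : ℂ) ^ 2 + c)⁻¹ + 2 * ((r : ℂ) ^ 2 / (((r : ℂ) ^ 2 + c) * ((r : ℂ) ^ 2 + c)))) r := by
  have d : HasDerivAt (fun r : ℝ => (r : ℂ)) 1 r := Complex.ofRealCLM.hasDerivAt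
  refine (d.neg.div ((d.pow 2).add_const c) h).congr_deriv ?_
  simp only [Pi.pow_apply, Pi.neg_apply]
  field_simp
  simp
  ring

lemma tendsto_neg_div_sq_add (c : ℂ) :
    Tendsto (fun r : ℝ => -(r : ℂ) / ((r : ℂ) ^ 2 + c)) atTop (𝓝 0) := by
  have h0 := tendsto_ofReal_inv_atTop
  have h1 : Tendsto (fun r : ℝ => -(r : ℂ)⁻¹ / (1 + c * ((r : ℂ)⁻¹) ^ 2)) atTop (𝓝 0) := by
    simpa [Pi.div_def] using h0.neg.div (((h0.pow 2).const_mul c).const_add 1) (by simp)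
  refine h1.congr' ?_
  filter_upwards [eventually_gt_atTop 0] with r hr
  have hr' : (r : ℂ) ≠ 0 := by exact_mod_cast hr.ne'
  have : (1 + c * ((r : ℂ)⁻¹) ^ 2) = ((r : ℂ) ^ 2 + c) / (r : ℂ) ^ 2 := by field_simp
  rw [this, div_div_eq_mul_div]
  congr 1
  field_simp

lemma integral_sq_div_sq_add_mul_sq_add {a b : ℂ} (ha : 0 < a.re) (ha2 : 0 ≤ (a ^ 2).re)
    (hb : b = 0 ∨ 0 < b.re) (hb2 : 0 ≤ (b ^ 2).re) :
    ∫ r : ℝ, (r : ℂ) ^ 2 / (((r : ℂ) ^ 2 + a ^ 2) * ((r : ℂ) ^ 2 + b ^ 2)) =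
      Real.pi / (a + b) := by
  have ha0 : a ≠ 0 := fun h => by simp [h] at ha
  have iA := integrable_inv_sq_add ha2 (pow_ne_zero 2 ha0)
  have nA := sq_add_ne_zero ha2 (pow_ne_zero 2 ha0)
  have hab : a + b ≠ 0 := by
    rcases hb with rfl | hb
    · simpa using ha0
    · intro h
      have := congrArg Complex.re h
      simp at this
      linarith
  by_cases hne : a = b
  · subst hne
    have hint : Integrable fun r : ℝ =>
        (r : ℂ) ^ 2 / (((r : ℂ) ^ 2 + a ^ 2) * ((r : ℂ) ^ 2 + a ^ 2)) := by
      have e : (fun r : ℝ => (r : ℂ) ^ 2 / (((r : ℂ) ^ 2 + a ^ 2) * ((r : ℂ) ^ 2 + a ^ 2))) =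
          fun r : ℝ => ((r : ℂ) ^ 2 / ((r : ℂ) ^ 2 + a ^ 2)) * ((r : ℂ) ^ 2 + a ^ 2)⁻¹ := by
        ext r
        rw [div_mul_eq_div_div, div_eq_mul_inv _ (_ + _)]
      rw [e]
      refine iA.bdd_mul (c := 2) (Measurable.aestronglyMeasurable (by fun_prop))
        (ae_of_all _ fun r => ?_)
      rw [norm_div, div_le_iff₀ (norm_pos_iff.2 (nA r))]
      have := sq_add_norm_le_two_mul_norm_sq_add ha2 r
      have h2 : ‖(r : ℂ) ^ 2‖ = r ^ 2 := by simp
      rw [h2]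
      linarith [norm_nonneg (a ^ 2)]
    have key := integral_of_hasDerivAt_of_tendsto
      (fun r => hasDerivAt_neg_div_sq_add (nA r)) (iA.neg.add (hint.const_mul 2)) (m := 0)
      ?_ (tendsto_neg_div_sq_add _)
    · rw [integral_add (f := fun r : ℝ => -((r : ℂ) ^ 2 + a ^ 2)⁻¹) iA.neg
        (hint.const_mul 2), integral_neg, integral_const_mul,
        integral_inv_complex_sq_add_sq ha ha2] at key
      have h3 : (Real.pi : ℂ) / (a + a) = (Real.pi / a) / 2 := by
        field_simp
        ring
      rw [h3]
      linear_combination key / 2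
    · have := ((tendsto_neg_div_sq_add (a ^ 2)).comp tendsto_neg_atBot_atTop).neg
      rw [neg_zero] at this
      refine this.congr fun r => ?_
      simp [neg_div]
  · have hsub : a - b ≠ 0 := sub_ne_zero.2 hne
    have iB : Integrable fun r : ℝ => b ^ 2 * ((r : ℂ) ^ 2 + b ^ 2)⁻¹ := by
      rcases hb with rfl | hb
      · simp
      · exact (integrable_inv_sq_add hb2
          (pow_ne_zero 2 fun h => by simp [h] at hb)).const_mul _
    have eB : ∫ r : ℝ, b ^ 2 * ((r : ℂ) ^ 2 + b ^ 2)⁻¹ = Real.pi * b := by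
      rcases hb with rfl | hb
      · simp
      · have hb0 : b ≠ 0 := fun h => by simp [h] at hb
        rw [integral_const_mul, integral_inv_complex_sq_add_sq hb hb2]
        field_simp
    have hcongr : (fun r : ℝ => (r : ℂ) ^ 2 / (((r : ℂ) ^ 2 + a ^ 2) * ((r : ℂ) ^ 2 + b ^ 2)))
        =ᵐ[volume] fun r : ℝ => ((a - b) * (a + b))⁻¹ *
          (a ^ 2 * ((r : ℂ) ^ 2 + a ^ 2)⁻¹ - b ^ 2 * ((r : ℂ) ^ 2 + b ^ 2)⁻¹) := by
      filter_upwards [ae_ne_zero] with r hr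
      have n1 := nA r
      have n2 : (r : ℂ) ^ 2 + b ^ 2 ≠ 0 := by
        by_cases hb0 : b = 0
        · simp [hb0, hr]
        · exact sq_add_ne_zero hb2 (pow_ne_zero 2 hb0) r
      field_simp
      ring
    rw [integral_congr_ae hcongr, integral_const_mul, integral_sub (iA.const_mul _) iB, eB,
      integral_const_mul, integral_inv_complex_sq_add_sq ha ha2]
    field_simp

lemma integrableOn_cexp_neg_mul_Ioi {c : ℂ} (hc : 0 < c.re) :
    IntegrableOn (fun t : ℝ => Complex.exp (-c * t)) (Ioi 0) :=
  integrableOn_exp_mul_complex_Ioi (by simpa using hc) 0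

lemma integral_cexp_neg_mul_Ioi {c : ℂ} (hc : 0 < c.re) :
    ∫ t in Ioi (0 : ℝ), Complex.exp (-c * t) = c⁻¹ := by
  rw [integral_exp_mul_complex_Ioi (by simpa using hc)]
  simp

lemma integral_norm_cexp_neg_mul_Ioi {c : ℂ} (hc : 0 < c.re) :
    ∫ t in Ioi (0 : ℝ), ‖Complex.exp (-c * t)‖ = c.re⁻¹ := by
  have h : ∀ t : ℝ, ‖Complex.exp (-c * t)‖ = Real.exp (-c.re * t) := fun t => by
    simp [Complex.norm_exp]
  simp_rw [h]
  rw [integral_exp_mul_Ioi (by simpa using hc)]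
  simp

lemma integrable_exp_neg_div_one_add {a b : ℝ} (ha : 0 ≤ a) (hb : 0 ≤ b) (hab : 0 < a + b) :
    Integrable fun s : ℝ => Real.exp (-a * s ^ 2) * (1 + b * s ^ 2)⁻¹ := by
  refine (integrable_inv_one_add_mul_sq hab).mono'
    (Measurable.aestronglyMeasurable (by fun_prop)) (ae_of_all _ fun s => ?_)
  have h1 : 0 ≤ a * s ^ 2 := by positivity
  have h2 : 0 ≤ b * s ^ 2 := by positivity
  have h3 := Real.add_one_le_exp (a * s ^ 2)
  rw [Real.norm_of_nonneg (by positivity), neg_mul, Real.exp_neg, ← mul_inv]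
  refine inv_anti₀ (by nlinarith) ?_
  nlinarith [mul_le_mul_of_nonneg_right h3 (by linarith : 0 ≤ 1 + b * s ^ 2)]

lemma integral_cexp_neg_mul_sq_div_one_add {p q : ℂ} (hp : 0 ≤ p.re) (hq : 0 ≤ q.re)
    (hpq : 0 < p.re + q.re) (hu : ∀ u : ℝ, 0 < u → 0 < (p + q * u).re) :
    ∫ s : ℝ, Complex.exp (-p * (s : ℂ) ^ 2) / (1 + q * (s : ℂ) ^ 2) =
      ∫ u in Ioi (0 : ℝ), Complex.exp (-u) * (Real.pi / (p + q * u)) ^ (1 / 2 : ℂ) := by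
  have hc : ∀ s : ℝ, (1 + q * (s : ℂ) ^ 2).re = 1 + q.re * s ^ 2 := fun s => by
    simp [← Complex.ofReal_pow]
  have hc0 : ∀ s : ℝ, 0 < (1 + q * (s : ℂ) ^ 2).re := fun s => by
    rw [hc]
    positivity
  have hint : Integrable (Function.uncurry fun s u : ℝ =>
      Complex.exp (-p * (s : ℂ) ^ 2) * Complex.exp (-(1 + q * (s : ℂ) ^ 2) * u))
      (volume.prod (volume.restrict (Ioi 0))) := by
    rw [integrable_prod_iff (Continuous.aestronglyMeasurable (by fun_prop))]
    refine ⟨ae_of_all _ fun s => (integrableOn_cexp_neg_mul_Ioi (hc0 s)).const_mul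
      (Complex.exp (-p * (s : ℂ) ^ 2)), ?_⟩
    refine (integrable_exp_neg_div_one_add hp hq hpq).congr (ae_of_all _ fun s => ?_)
    simp only [Function.uncurry_apply_pair, norm_mul]
    rw [integral_const_mul, integral_norm_cexp_neg_mul_Ioi (hc0 s), hc]
    simp [Complex.norm_exp, ← Complex.ofReal_pow]
  have h := integral_integral_swap hint
  simp_rw [integral_const_mul, fun s : ℝ => integral_cexp_neg_mul_Ioi (hc0 s)] at h
  simp_rw [div_eq_mul_inv (Complex.exp _)]
  rw [h]
  refine setIntegral_congr_fun measurableSet_Ioi fun u hu0 => ?_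
  rw [← integral_gaussian_complex (hu u hu0), ← integral_const_mul]
  refine integral_congr_ae (ae_of_all _ fun s => ?_)
  simp only [← Complex.exp_add]
  congr 1
  ring

lemma eq_of_sq_eq_sq_of_re_pos {z w : ℂ} (h : z ^ 2 = w ^ 2) (hz : 0 < z.re) (hw : 0 < w.re) :
    z = w := by
  rcases sq_eq_sq_iff_eq_or_eq_neg.1 h with h | h
  · exact h
  · have := congrArg Complex.re h
    simp only [Complex.neg_re] at this
    linarith

lemma re_cpow_half_pos {z : ℂ} (hz : 0 < z.re) : 0 < (z ^ (1 / 2 : ℂ)).re := by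
  rw [one_div, Complex.cpow_inv_two_re]
  exact Real.sqrt_pos.2 (by positivity)

lemma cpow_half_sq (z : ℂ) : (z ^ (1 / 2 : ℂ)) ^ 2 = z := by
  rw [one_div]
  exact Complex.cpow_nat_inv_pow z two_ne_zero

lemma ofReal_sqrt_two_sq : ((√2 : ℝ) : ℂ) ^ 2 = 2 := by
  rw [← Complex.ofReal_pow, Real.sq_sqrt zero_le_two]
  norm_num

lemma ofReal_sqrt_two_ne_zero : ((√2 : ℝ) : ℂ) ≠ 0 := by
  simp

lemma re_pi_div_pos {z : ℂ} (hz : 0 < z.re) : 0 < ((Real.pi : ℂ) / z).re := by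
  have h0 : z ≠ 0 := fun h => by simp [h] at hz
  rw [div_eq_mul_inv, Complex.re_ofReal_mul, Complex.inv_re]
  have := Complex.normSq_pos.2 h0
  have := Real.pi_pos
  positivity

lemma cpow_half_rotate {t u : ℝ} (ht : 0 < t) (hu : 0 < u) :
    (Real.pi / (I * t + 1 * u)) ^ (1 / 2 : ℂ) =
      (1 - I) / (√2 : ℝ) * (Real.pi / (t + -I * u)) ^ (1 / 2 : ℂ) := by
  have r2 : 0 < ((t : ℂ) + -I * u).re := by simpa using ht
  have n2 : (t : ℂ) + -I * u ≠ 0 := fun h => by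
    rw [h] at r2
    simp at r2
  set w := ((Real.pi : ℂ) / (t + -I * u)) ^ (1 / 2 : ℂ) with hw
  have hw2 : w ^ 2 = Real.pi / (t + -I * u) := cpow_half_sq _
  have hwre : 0 < w.re := re_cpow_half_pos (re_pi_div_pos r2)
  have him : 0 < (w ^ 2).im := by
    rw [hw2, div_eq_mul_inv, Complex.im_ofReal_mul, Complex.inv_im]
    have := Complex.normSq_pos.2 n2
    have := Real.pi_pos
    have e : -((t : ℂ) + -I * u).im = u := by simp
    rw [e]
    positivity
  have hwim : 0 < w.im := by
    have e : (w ^ 2).im = 2 * w.re * w.im := by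
      rw [sq, Complex.mul_im]
      ring
    rw [e] at him
    exact pos_of_mul_pos_right him (by positivity)
  refine eq_of_sq_eq_sq_of_re_pos ?_ (re_cpow_half_pos (re_pi_div_pos (by simpa using hu))) ?_
  · rw [cpow_half_sq, mul_pow, hw2, div_pow, ofReal_sqrt_two_sq]
    have e1 : (1 - I) ^ 2 = -2 * I := by linear_combination I_sq
    have e2 : I * t + 1 * (u : ℂ) = I * (t + -I * u) := by linear_combination (u : ℂ) * I_sq
    rw [e1, e2, div_mul_eq_div_div, div_I]
    ring
  · have e : (1 - I) / ((√2 : ℝ) : ℂ) * w = (1 - I) * w / ((√2 : ℝ) : ℂ) := by ring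
    rw [e, Complex.div_ofReal_re]
    have : ((1 - I) * w).re = w.re + w.im := by simp
    rw [this]
    positivity

lemma integral_cexp_div_one_add_sq_rotate {t : ℝ} (ht : 0 < t) :
    ∫ s : ℝ, Complex.exp (-I * (s : ℂ) ^ 2 * t) / (1 + (s : ℂ) ^ 2) =
      (1 - I) / (√2 : ℝ) *
        ∫ r : ℝ, Complex.exp (-t * (r : ℂ) ^ 2) / (1 + -I * (r : ℂ) ^ 2) := by
  rw [integral_cexp_neg_mul_sq_div_one_add (p := t) (q := -I) (by simpa using ht.le) (by simp)
    (by simpa using ht) (fun u _ => by simpa using ht), ← integral_const_mul]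
  have h := integral_cexp_neg_mul_sq_div_one_add (p := I * t) (q := 1) (by simp) (by simp)
    (by simp) (fun u hu => by simpa using hu)
  have e : ∀ s : ℝ, Complex.exp (-I * (s : ℂ) ^ 2 * t) / (1 + (s : ℂ) ^ 2) =
      Complex.exp (-(I * t) * (s : ℂ) ^ 2) / (1 + 1 * (s : ℂ) ^ 2) := fun s => by
    rw [one_mul]
    congr 2
    ring
  simp_rw [e]
  rw [h]
  refine setIntegral_congr_fun measurableSet_Ioi fun u hu => ?_
  rw [cpow_half_rotate ht hu]
  ring

lemma neumannLS_eq_integral {t : ℝ} (ht : 0 < t) :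
    neumannLS t = (1 - I) / (√2 : ℝ) / Real.pi *
      ∫ r : ℝ, (r : ℂ) ^ 2 / ((r : ℂ) ^ 2 + I) * Complex.exp (-t * (r : ℂ) ^ 2) := by
  have hpi : (Real.pi : ℂ) ≠ 0 := by exact_mod_cast Real.pi_ne_zero
  have hI : ∀ r : ℝ, (r : ℂ) ^ 2 + I ≠ 0 := sq_add_ne_zero (by simp) I_ne_zero
  have hI' : ∀ r : ℝ, 1 + -I * (r : ℂ) ^ 2 = -I * ((r : ℂ) ^ 2 + I) := fun r => by
    linear_combination I_sq
  have hI'' : ∀ r : ℝ, (1 + -I * (r : ℂ) ^ 2)⁻¹ = I * ((r : ℂ) ^ 2 + I)⁻¹ := fun r => by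
    rw [hI', mul_inv]
    simp
  have g1 : Integrable fun r : ℝ => Complex.exp (-t * (r : ℂ) ^ 2) :=
    integrable_cexp_neg_mul_sq (b := t) (by simpa using ht)
  have g2 : Integrable fun r : ℝ =>
      Complex.exp (-t * (r : ℂ) ^ 2) / (1 + -I * (r : ℂ) ^ 2) := by
    simp_rw [div_eq_mul_inv, hI'']
    refine ((integrable_inv_sq_add (c := I) (by simp) I_ne_zero).const_mul I).bdd_mul (c := 1)
      (by fun_prop) (ae_of_all _ fun r => ?_)
    rw [Complex.norm_exp]
    simp [← Complex.ofReal_pow]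
    positivity
  have hg : (1 - I) / ((√(2 * Real.pi * t) : ℝ) : ℂ) = (1 - I) / (√2 : ℝ) / Real.pi *
      ∫ r : ℝ, Complex.exp (-t * (r : ℂ) ^ 2) := by
    have e : ∀ r : ℝ, Complex.exp (-t * (r : ℂ) ^ 2) = ((Real.exp (-t * r ^ 2) : ℝ) : ℂ) :=
      fun r => by push_cast; rfl
    simp_rw [e]
    rw [integral_complex_ofReal, integral_gaussian, mul_assoc, Real.sqrt_mul zero_le_two,
      Real.sqrt_mul Real.pi_pos.le, Real.sqrt_div Real.pi_pos.le]
    have h1 : ((√Real.pi : ℝ) : ℂ) ^ 2 = Real.pi := by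
      rw [← Complex.ofReal_pow, Real.sq_sqrt Real.pi_pos.le]
    have h2 : ((√Real.pi : ℝ) : ℂ) ≠ 0 := by
      exact_mod_cast (Real.sqrt_pos.2 Real.pi_pos).ne'
    have h3 : ((√t : ℝ) : ℂ) ≠ 0 := by exact_mod_cast (Real.sqrt_pos.2 ht).ne'
    have h4 := ofReal_sqrt_two_ne_zero
    push_cast
    field_simp
    rw [h1]
  rw [neumannLS, hg, integral_cexp_div_one_add_sq_rotate ht]
  have e : ∀ r : ℝ, (r : ℂ) ^ 2 / ((r : ℂ) ^ 2 + I) * Complex.exp (-t * (r : ℂ) ^ 2) =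
      Complex.exp (-t * (r : ℂ) ^ 2) -
        Complex.exp (-t * (r : ℂ) ^ 2) / (1 + -I * (r : ℂ) ^ 2) := fun r => by
    have := hI r
    rw [div_eq_mul_inv (Complex.exp _), hI'']
    field_simp
    ring
  simp_rw [e]
  rw [integral_sub g1 g2]
  ring

lemma integrable_sq_div_mul_cexp {w : ℂ} (hw : 0 ≤ w.re) :
    Integrable (Function.uncurry fun t r : ℝ =>
      (r : ℂ) ^ 2 / ((r : ℂ) ^ 2 + I) * Complex.exp (-((r : ℂ) ^ 2 + w) * t))
      ((volume.restrict (Ioi 0)).prod volume) := by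
  have hre : ∀ r : ℝ, ((r : ℂ) ^ 2 + w).re = r ^ 2 + w.re := fun r => by
    simp [← Complex.ofReal_pow]
  have hpos : ∀ r : ℝ, r ≠ 0 → 0 < ((r : ℂ) ^ 2 + w).re := fun r hr => by
    rw [hre]
    positivity
  rw [integrable_prod_iff' (Measurable.aestronglyMeasurable (by fun_prop))]
  constructor
  · filter_upwards [ae_ne_zero] with r hr
    exact (integrableOn_cexp_neg_mul_Ioi (hpos r hr)).const_mul ((r : ℂ) ^ 2 / ((r : ℂ) ^ 2 + I))
  · have h : Integrable fun r : ℝ => ‖(r : ℂ) ^ 2 / ((r : ℂ) ^ 2 + I)‖ * (r ^ 2 + w.re)⁻¹ := by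
      refine (integrable_inv_sq_add (c := I) (by simp) I_ne_zero).norm.mono'
        (Measurable.aestronglyMeasurable (by fun_prop)) (ae_of_all _ fun r => ?_)
      rw [Real.norm_of_nonneg (by positivity), div_eq_mul_inv, norm_mul, mul_right_comm]
      refine mul_le_of_le_one_left (norm_nonneg _) ?_
      have e : ‖(r : ℂ) ^ 2‖ = r ^ 2 := by simp
      rw [e, ← div_eq_mul_inv]
      exact div_le_one_of_le₀ (by linarith) (by positivity)
    refine h.congr ?_
    filter_upwards [ae_ne_zero] with r hr
    simp only [Function.uncurry_apply_pair, norm_mul]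
    rw [integral_const_mul, integral_norm_cexp_neg_mul_Ioi (hpos r hr), hre]

lemma cexp_mul_neumannLS (k : ℂ) {t : ℝ} (ht : 0 < t) :
    Complex.exp (I * k ^ 2 * t) * neumannLS t = (1 - I) / (√2 : ℝ) / Real.pi *
      ∫ r : ℝ, (r : ℂ) ^ 2 / ((r : ℂ) ^ 2 + I) *
        Complex.exp (-((r : ℂ) ^ 2 + -(I * k ^ 2)) * t) := by
  rw [neumannLS_eq_integral ht, mul_left_comm, ← integral_const_mul]
  congr 2
  ext r
  rw [mul_left_comm, ← Complex.exp_add]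
  congr 2
  ring

lemma re_neg_I_mul_sq_nonneg {k : ℂ} (hre : k.re ≤ 0) (him : k.im ≤ 0) :
    0 ≤ (-(I * k ^ 2)).re := by
  have e : (-(I * k ^ 2)).re = 2 * (k.re * k.im) := by
    simp [sq]
    ring
  rw [e]
  have := mul_nonneg_of_nonpos_of_nonpos hre him
  positivity

lemma integral_sq_div_sq_add_I_mul {k : ℂ} (hre : k.re ≤ 0) (him : k.im ≤ 0) :
    ∫ r : ℝ, (r : ℂ) ^ 2 / (((r : ℂ) ^ 2 + I) * ((r : ℂ) ^ 2 + -(I * k ^ 2))) =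
      Real.pi / ((1 + I) / (√2 : ℝ) * (1 + I * k)) := by
  have ea : ((1 + I) / ((√2 : ℝ) : ℂ)) ^ 2 = I := by
    rw [div_pow, ofReal_sqrt_two_sq]
    linear_combination I_sq / 2
  have eb : ((1 + I) / ((√2 : ℝ) : ℂ) * (I * k)) ^ 2 = -(I * k ^ 2) := by
    rw [mul_pow, ea]
    linear_combination I * k ^ 2 * I_sq
  have hb : ((1 + I) / ((√2 : ℝ) : ℂ) * (I * k)).re = (-k.re - k.im) / √2 := by
    have e : (1 + I) / ((√2 : ℝ) : ℂ) * (I * k) = ((1 + I) * (I * k)) / ((√2 : ℝ) : ℂ) := by ring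
    rw [e, Complex.div_ofReal_re]
    simp
    ring
  have h := integral_sq_div_sq_add_mul_sq_add (a := (1 + I) / ((√2 : ℝ) : ℂ))
    (b := (1 + I) / ((√2 : ℝ) : ℂ) * (I * k)) (by rw [Complex.div_ofReal_re]; simp)
    (by rw [ea]; simp) ?_ (by rw [eb]; exact re_neg_I_mul_sq_nonneg hre him)
  · rw [ea, eb] at h
    rw [h]
    congr 1
    ring
  · by_cases hk : k = 0
    · simp [hk]
    · refine Or.inr ?_
      rw [hb]
      refine div_pos ?_ (by positivity)
      by_contra hcon
      exact hk (Complex.ext (by simp; linarith) (by simp; linarith))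

end

/-- The global relation `q̂₀(k) = i g̃₁(k)` for the linear Schrödinger half-line problem with
initial datum `e^{-x}` and homogeneous Dirichlet data: for every `k` in the closed third
quadrant, `∫₀^∞ e^{ik²t} g₁(t) dt` converges absolutely and
`i ∫₀^∞ e^{ik²t} g₁(t) dt = 1/(1+ik) = ∫₀^∞ e^{-ikx} e^{-x} dx`. -/
theorem neumannLS_global_relation (k : ℂ) (hre : k.re ≤ 0) (him : k.im ≤ 0) :
    IntegrableOn (fun t : ℝ => Complex.exp (Complex.I * k ^ 2 * (t : ℂ)) * neumannLS t)
      (Ioi 0) ∧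
    Complex.I * ∫ t in Ioi (0 : ℝ), Complex.exp (Complex.I * k ^ 2 * (t : ℂ)) * neumannLS t
      = 1 / (1 + Complex.I * k) ∧
    (∫ x in Ioi (0 : ℝ), Complex.exp (-(Complex.I) * k * (x : ℂ)) * Complex.exp (-(x : ℂ)))
      = 1 / (1 + Complex.I * k) := by
  have hw := integrable_sq_div_mul_cexp (re_neg_I_mul_sq_nonneg hre him)
  have hk : 0 < (1 + I * k).re := by
    simp
    linarith
  have hk0 : 1 + I * k ≠ 0 := fun h => by simp [h] at hk
  refine ⟨?_, ?_, ?_⟩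
  · refine IntegrableOn.congr_fun (hw.integral_prod_left.const_mul ((1 - I) / (√2 : ℝ) / Real.pi))
      (fun t ht => ?_) measurableSet_Ioi
    exact (cexp_mul_neumannLS k ht).symm
  · rw [setIntegral_congr_fun measurableSet_Ioi fun t ht => cexp_mul_neumannLS k ht,
      integral_const_mul, integral_integral_swap hw]
    have e : ∀ᵐ r : ℝ, ∫ t in Ioi (0 : ℝ), (r : ℂ) ^ 2 / ((r : ℂ) ^ 2 + I) *
        Complex.exp (-((r : ℂ) ^ 2 + -(I * k ^ 2)) * t) =
        (r : ℂ) ^ 2 / (((r : ℂ) ^ 2 + I) * ((r : ℂ) ^ 2 + -(I * k ^ 2))) := by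
      filter_upwards [ae_ne_zero] with r hr
      have h0 := re_neg_I_mul_sq_nonneg hre him
      rw [integral_const_mul, integral_cexp_neg_mul_Ioi, div_mul_eq_div_div, ← div_eq_mul_inv]
      rw [Complex.add_re, ← Complex.ofReal_pow, Complex.ofReal_re]
      positivity
    rw [integral_congr_ae e, integral_sq_div_sq_add_I_mul hre him]
    have hpi : (Real.pi : ℂ) ≠ 0 := by exact_mod_cast Real.pi_ne_zero
    have h2 := ofReal_sqrt_two_ne_zero
    have hI : 1 + I ≠ 0 := fun h => by simpa using congrArg Complex.re h
    field_simp
    linear_combination -I_sq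
  · have e : ∀ x : ℝ, Complex.exp (-I * k * x) * Complex.exp (-x) =
        Complex.exp (-(1 + I * k) * x) := fun x => by
      rw [← Complex.exp_add]
      congr 1
      ring
    simp_rw [e]
    rw [integral_cexp_neg_mul_Ioi hk, one_div]
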